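/- Let σ₁ > 0, σ₂ > 0, 0 < p < 1, τ > U_tol, α ∈ (0, 1), β ∈ (0, 1), and let z_α, z_β be real numbers with Φ(z_α) = 1 − α/2, Φ(z_β) = 1 − β, and z_α + z_β > 0, where Φ is the cumulative distribution function of the standard Gaussian measure (mean 0, variance 1). Let n > 0 satisfy n ≥ (z_α + z_β)² (σ₁²/p + σ₂²/(1 − p)) / (τ − U_tol)², and set σ_U = √(σ₁²/(n p) + σ₂²/(n (1 − p))). Then the Gaussian measure on ℝ with mean τ and variance σ_U² assigns to the set {x : x > U_tol + z_α · σ_U} a mass of at least 1 − β. -/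

import Mathlib

open MeasureTheory ProbabilityTheory

lemma gaussianReal_eq_map_const_sub_const_mul (μ s : ℝ) :
    gaussianReal μ ⟨s ^ 2, sq_nonneg s⟩ = (gaussianReal 0 1).map (fun x ↦ μ - s * x) := by
  have h : (fun x : ℝ ↦ μ - s * x) = (fun x ↦ μ - x) ∘ (fun x ↦ s * x) := rfl
  rw [h, ← Measure.map_map (by fun_prop) (by fun_prop), gaussianReal_map_const_mul,
    gaussianReal_map_const_sub]
  simp only [mul_zero, mul_one, sub_zero]
  rfl

/-- The upper tail of a Gaussian of mean `μ` and standard deviation `s` beyond `t` has mass at least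
`Φ z` as soon as `t` lies at least `z` standard deviations below the mean. -/
lemma ofReal_cdf_le_gaussianReal_Ioi {μ s t z : ℝ} (hs : 0 < s) (h : t + z * s ≤ μ) :
    ENNReal.ofReal (cdf (gaussianReal 0 1) z) ≤
      gaussianReal μ ⟨s ^ 2, sq_nonneg s⟩ (Set.Ioi t) := by
  have := nullSingletonClass_gaussianReal (μ := 0) (v := 1) one_ne_zero
  rw [ofReal_cdf, gaussianReal_eq_map_const_sub_const_mul,
    Measure.map_apply (by fun_prop) measurableSet_Ioi, ← measure_congr Iio_ae_eq_Iic]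
  refine measure_mono fun x hx ↦ ?_
  have hx' : x < z := hx
  change t < μ - s * x
  nlinarith

theorem sample_size_gives_power (σ₁ σ₂ p τ Utol α β zα zβ n : ℝ)
    (hσ₁ : 0 < σ₁) (hσ₂ : 0 < σ₂) (hp0 : 0 < p) (hp1 : p < 1)
    (hτ : τ > Utol) (hα : α ∈ Set.Ioo (0 : ℝ) 1) (hβ : β ∈ Set.Ioo (0 : ℝ) 1)
    (hzα : cdf (gaussianReal 0 1) zα = 1 - α / 2)
    (hzβ : cdf (gaussianReal 0 1) zβ = 1 - β)
    (hz : 0 < zα + zβ) (hn : 0 < n)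
    (hsize : n ≥ (zα + zβ) ^ 2 * (σ₁ ^ 2 / p + σ₂ ^ 2 / (1 - p)) / (τ - Utol) ^ 2) :
    gaussianReal τ ⟨(Real.sqrt (σ₁ ^ 2 / (n * p) + σ₂ ^ 2 / (n * (1 - p)))) ^ 2,
        sq_nonneg _⟩
      {x : ℝ | x > Utol + zα * Real.sqrt (σ₁ ^ 2 / (n * p) + σ₂ ^ 2 / (n * (1 - p)))}
      ≥ ENNReal.ofReal (1 - β) := by
  have hq : 0 < 1 - p := sub_pos.2 hp1
  have hd : 0 < τ - Utol := sub_pos.2 hτ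
  have hV : σ₁ ^ 2 / (n * p) + σ₂ ^ 2 / (n * (1 - p)) =
      (σ₁ ^ 2 / p + σ₂ ^ 2 / (1 - p)) / n := by field_simp
  have hpos : 0 < σ₁ ^ 2 / (n * p) + σ₂ ^ 2 / (n * (1 - p)) := by positivity
  set s := Real.sqrt (σ₁ ^ 2 / (n * p) + σ₂ ^ 2 / (n * (1 - p))) with hs
  have hs0 : 0 < s := Real.sqrt_pos.2 hpos
  have hle : (zα + zβ) * s ≤ τ - Utol := by
    refine le_of_abs_le (abs_le_of_sq_le_sq ?_ hd.le)
    rw [mul_pow, hs, Real.sq_sqrt hpos.le, hV, ← mul_div_assoc, div_le_iff₀ hn, mul_comm _ n]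
    exact (div_le_iff₀ (by positivity)).1 hsize
  rw [← hzβ]
  exact ofReal_cdf_le_gaussianReal_Ioi hs0 (by linarith)
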